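/- arXiv:1312.2516 — 2 statements merged into one kernel-verified Lean document; each statement's English description precedes it below -/
import Mathlib

section
/- Let f ∈ Cvx₀(ℝⁿ) and let x be a point with f(x) ≠ 0 and f(x) ≠ +∞. If f is differentiable at the origin, or more generally if there is no δ > 0 such that f restricted to the segment [0, (1+δ)x] is linear, then f(x) · Jf(x/f(x)) = 1. -/
open scoped ENNReal RealInnerProductSpace
open Set

noncomputable section

/-- Euclidean space `ℝⁿ`. -/
abbrev Euc (n : ℕ) := EuclideanSpace ℝ (Fin n)

/-- The polarity transform `𝒫`:
`(Pf)(y) = inf {c ≥ 0 : ⟨x,y⟩ ≤ 1 + c·f(x) for all x}`, with `inf ∅ = ∞`.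
(Nonnegativity of `c` is automatic since we work in `ℝ≥0∞`.) -/
def polarT {n : ℕ} (f : Euc n → ℝ≥0∞) (y : Euc n) : ℝ≥0∞ :=
  sInf {c : ℝ≥0∞ | ∀ x : Euc n, ENNReal.ofReal ⟪x, y⟫ ≤ 1 + c * f x}

/-- The class `Cvx₀(ℝⁿ)` of geometric convex functions: lower semicontinuous, convex,
nonnegative (automatic), vanishing at the origin. -/
def GeomConvexOn {n : ℕ} (f : Euc n → ℝ≥0∞) : Prop :=
  (∀ x y : Euc n, ∀ a b : ℝ, 0 ≤ a → 0 ≤ b → a + b = 1 →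
    f (a • x + b • y) ≤ ENNReal.ofReal a * f x + ENNReal.ofReal b * f y) ∧
  LowerSemicontinuous f ∧ f 0 = 0

/-- The polar set `K° = {y : ⟨x,y⟩ ≤ 1 ∀ x ∈ K}`. -/
def polarSet {n : ℕ} (K : Set (Euc n)) : Set (Euc n) :=
  {y : Euc n | ∀ x ∈ K, ⟪x, y⟫ ≤ 1}

/-- The Legendre transform `(Lf)(y) = sup_x (⟨x,y⟩ - f(x))` of a `[0,∞]`-valued function,
with values in `[0,∞]` (for `f` with `f(0) = 0` the supremum is automatically `≥ 0`,
so the `ℝ≥0∞`-valued truncated subtraction computes the genuine Legendre transform). -/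
def legendreT {n : ℕ} (f : Euc n → ℝ≥0∞) (y : Euc n) : ℝ≥0∞ :=
  ⨆ x : Euc n, ENNReal.ofReal ⟪x, y⟫ - f x

/-- The usual subdifferential `∂g(x) = {y : g(z) ≥ g(x) + ⟨z - x, y⟩ ∀ z}`,
stated in `EReal` to accommodate `[0,∞]`-valued functions. -/
def subdiff {n : ℕ} (g : Euc n → ℝ≥0∞) (x : Euc n) : Set (Euc n) :=
  {y : Euc n | ∀ z : Euc n, (g x : EReal) + ((⟪z - x, y⟫ : ℝ) : EReal) ≤ (g z : EReal)}

/-- The polar subdifferential `∂°f(x) = {y ∈ dom(Pf) : Pf(y)·f(x) = ⟨x,y⟩ - 1}`. -/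
def polarSubdiff {n : ℕ} (f : Euc n → ℝ≥0∞) (x : Euc n) : Set (Euc n) :=
  {y : Euc n | polarT f y ≠ ∞ ∧
    (polarT f y : EReal) * (f x : EReal) = ((⟪x, y⟫ - 1 : ℝ) : EReal)}

/-- `g` restricted to the segment `[0,x]` is linear (i.e. `g(t•x) = c·t` for `t ∈ [0,1]`). -/
def RayLinear {n : ℕ} (g : Euc n → ℝ≥0∞) (x : Euc n) : Prop :=
  ∃ c : ℝ, 0 ≤ c ∧ ∀ t : ℝ, t ∈ Icc (0:ℝ) 1 → g (t • x) = ENNReal.ofReal (c * t)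

/-- `g` is not linear on `[0,x+]`: there is no `t > 1` such that `g` is linear on `[0,t•x]`. -/
def NotLinearPlus {n : ℕ} (g : Euc n → ℝ≥0∞) (x : Euc n) : Prop :=
  ¬ ∃ t : ℝ, 1 < t ∧ RayLinear g (t • x)

/-- `f` is nonlinear at infinity: for every ray `ℝ⁺x`, `t ↦ f(tx)` is finite everywhere and
is not squeezed between `at - b` and `at` for any `a ≥ 0`, `b > 0`. -/
def NonlinearAtInfinity {n : ℕ} (f : Euc n → ℝ≥0∞) : Prop :=
  ∀ x : Euc n, x ≠ 0 →
    (∀ t : ℝ, 0 ≤ t → f (t • x) ≠ ∞) ∧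
    ¬ ∃ a b : ℝ, 0 ≤ a ∧ 0 < b ∧ ∀ t : ℝ, 0 ≤ t →
        ENNReal.ofReal (a * t - b) ≤ f (t • x) ∧ f (t • x) ≤ ENNReal.ofReal (a * t)

/-- The class `S₁(ℝⁿ)`: geometric convex functions which are finite-valued, continuously
differentiable off the origin, and strictly convex. -/
def S1 {n : ℕ} (f : Euc n → ℝ≥0∞) : Prop :=
  GeomConvexOn f ∧ (∀ x, f x ≠ ∞) ∧
  ContDiffOn ℝ 1 (fun x => (f x).toReal) ({0}ᶜ : Set (Euc n)) ∧
  StrictConvexOn ℝ (univ : Set (Euc n)) (fun x => (f x).toReal)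

/-- The Hessian of a real-valued function, as the derivative of the gradient map. -/
def hess {n : ℕ} (g : Euc n → ℝ) (x : Euc n) : Euc n →L[ℝ] Euc n :=
  fderiv ℝ (fun z => gradient g z) x

/-- The class `S₂(ℝⁿ)`: geometric convex functions which are finite-valued, strictly convex,
twice continuously differentiable off the origin with positive definite Hessian there. -/
def S2 {n : ℕ} (f : Euc n → ℝ≥0∞) : Prop :=
  GeomConvexOn f ∧ (∀ x, f x ≠ ∞) ∧
  StrictConvexOn ℝ (univ : Set (Euc n)) (fun x => (f x).toReal) ∧
  ContDiffOn ℝ 2 (fun x => (f x).toReal) ({0}ᶜ : Set (Euc n)) ∧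
  ∀ x : Euc n, x ≠ 0 → ∀ v : Euc n, v ≠ 0 →
    0 < ⟪v, hess (fun z => (f z).toReal) x v⟫

/-- The defining inequality of `polarT f y` passes to the infimum where `f` is finite and
nonzero. -/
theorem ofReal_inner_le_one_add_polarT_mul {n : ℕ} (f : Euc n → ℝ≥0∞) (x y : Euc n)
    (h0 : f x ≠ 0) (hi : f x ≠ ∞) :
    ENNReal.ofReal ⟪x, y⟫ ≤ 1 + polarT f y * f x := by
  rw [← tsub_le_iff_left, ← ENNReal.div_le_iff h0 hi]
  refine le_sInf fun c hc => ?_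
  rw [ENNReal.div_le_iff h0 hi, tsub_le_iff_left]
  exact hc x

theorem legendreT_polarT_le_inv {n : ℕ} (f : Euc n → ℝ≥0∞) (x : Euc n)
    (h0 : f x ≠ 0) (hi : f x ≠ ∞) :
    legendreT (polarT f) ((f x).toReal⁻¹ • x) ≤ (f x)⁻¹ := by
  have ha : 0 < (f x).toReal := ENNReal.toReal_pos h0 hi
  refine iSup_le fun y => ?_
  rw [tsub_le_iff_right, inner_smul_right, ENNReal.ofReal_mul (by positivity),
    ENNReal.ofReal_inv_of_pos ha, ENNReal.ofReal_toReal hi, real_inner_comm]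
  calc (f x)⁻¹ * ENNReal.ofReal ⟪x, y⟫ ≤ (f x)⁻¹ * (1 + polarT f y * f x) := by
        gcongr
        exact ofReal_inner_le_one_add_polarT_mul f x y h0 hi
    _ = (f x)⁻¹ + polarT f y := by
        rw [mul_add, mul_one, mul_left_comm, ENNReal.inv_mul_cancel h0 hi, mul_one]

/-- The infimum defining `polarT` is at most `c` as soon as the inequality holds on the domain
of `f`, even when `c = 0`. -/
theorem polarT_le_ofReal {n : ℕ} (f : Euc n → ℝ≥0∞) (y : Euc n) (c : ℝ) (hc : 0 ≤ c)
    (h : ∀ z, f z ≠ ∞ → ⟪z, y⟫ ≤ 1 + c * (f z).toReal) : polarT f y ≤ ENNReal.ofReal c := by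
  refine ENNReal.le_of_forall_pos_le_add fun ε hε _ => sInf_le fun z => ?_
  by_cases hz : f z = ∞
  · rw [hz, ENNReal.mul_top (by simp [hε.ne'])]
    simp
  · calc ENNReal.ofReal ⟪z, y⟫ ≤ ENNReal.ofReal (1 + c * (f z).toReal) :=
          ENNReal.ofReal_le_ofReal (h z hz)
      _ = 1 + ENNReal.ofReal c * f z := by
          rw [ENNReal.ofReal_add zero_le_one (by positivity), ENNReal.ofReal_mul hc,
            ENNReal.ofReal_toReal hz, ENNReal.ofReal_one]
      _ ≤ 1 + (ENNReal.ofReal c + ε) * f z := by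
          gcongr
          exact le_self_add

theorem GeomConvexOn.le_smul {n : ℕ} {f : Euc n → ℝ≥0∞} (hf : GeomConvexOn f) (x : Euc n)
    {t : ℝ} (ht : 0 ≤ t) (ht1 : t ≤ 1) : f (t • x) ≤ ENNReal.ofReal t * f x := by
  simpa [hf.2.2] using hf.1 x 0 t (1 - t) ht (by linarith) (by ring)

/-- The real epigraph of a geometric convex function. -/
def realEpigraph {n : ℕ} (f : Euc n → ℝ≥0∞) : Set (Euc n × ℝ) :=
  {p | f p.1 ≤ ENNReal.ofReal p.2 ∧ 0 ≤ p.2}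

theorem GeomConvexOn.convex_realEpigraph {n : ℕ} {f : Euc n → ℝ≥0∞} (hf : GeomConvexOn f) :
    Convex ℝ (realEpigraph f) := by
  rintro ⟨x, s⟩ ⟨hx, hs⟩ ⟨y, t⟩ ⟨hy, ht⟩ a b ha hb hab
  dsimp only at hx hs hy ht
  refine ⟨(hf.1 x y a b ha hb hab).trans ?_, ?_⟩
  · calc ENNReal.ofReal a * f x + ENNReal.ofReal b * f y
        ≤ ENNReal.ofReal a * ENNReal.ofReal s + ENNReal.ofReal b * ENNReal.ofReal t := by gcongr
      _ = ENNReal.ofReal (a * s + b * t) := by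
          rw [ENNReal.ofReal_add (by positivity) (by positivity), ENNReal.ofReal_mul ha,
            ENNReal.ofReal_mul hb]
  · change 0 ≤ a * s + b * t
    positivity

theorem GeomConvexOn.isClosed_realEpigraph {n : ℕ} {f : Euc n → ℝ≥0∞} (hf : GeomConvexOn f) :
    IsClosed (realEpigraph f) := by
  have hcont : Continuous fun p : Euc n × ℝ => (p.1, ENNReal.ofReal p.2) :=
    continuous_fst.prodMk (ENNReal.continuous_ofReal.comp continuous_snd)
  exact (hf.2.1.isClosed_epigraph.preimage hcont).inter (isClosed_Ici.preimage continuous_snd)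

/-- A point outside the epigraph is separated from it by a normalized affine minorant. -/
theorem GeomConvexOn.exists_separating {n : ℕ} {f : Euc n → ℝ≥0∞} (hf : GeomConvexOn f)
    (w : Euc n) (r : ℝ) (hw : (w, r) ∉ realEpigraph f) :
    ∃ (y : Euc n) (c : ℝ), 0 ≤ c ∧ (∀ z, f z ≠ ∞ → ⟪z, y⟫ ≤ 1 + c * (f z).toReal) ∧
      1 < ⟪w, y⟫ - c * r := by
  obtain ⟨L, u, hL, hu⟩ := geometric_hahn_banach_closed_point hf.convex_realEpigraph
    hf.isClosed_realEpigraph hw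
  have hu0 : 0 < u := by
    have := hL 0 ⟨by simp [hf.2.2], le_rfl⟩
    simpa using this
  obtain ⟨v, hv⟩ : ∃ v : Euc n, ∀ z, ⟪z, v⟫ = L (z, 0) := by
    refine ⟨(InnerProductSpace.toDual ℝ (Euc n)).symm
      (L.comp (ContinuousLinearMap.inl ℝ (Euc n) ℝ)), fun z => ?_⟩
    rw [real_inner_comm, InnerProductSpace.toDual_symm_apply]
    simp
  have hsplit : ∀ z s, L (z, s) = ⟪z, v⟫ + s * L (0, 1) := fun z s => by
    rw [hv, ← smul_eq_mul, ← map_smul, ← map_add]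
    simp
  have hneg : L (0, 1) ≤ 0 := by
    by_contra! hpos
    have := hL (0, u / L (0, 1)) ⟨by simp [hf.2.2], by positivity⟩
    rw [hsplit, inner_zero_left, div_mul_cancel₀ _ hpos.ne'] at this
    linarith
  refine ⟨u⁻¹ • v, u⁻¹ * -L (0, 1), mul_nonneg (by positivity) (by linarith), fun z hz => ?_, ?_⟩
  · have := hL (z, (f z).toReal) ⟨by simp [ENNReal.ofReal_toReal hz], ENNReal.toReal_nonneg⟩
    rw [hsplit] at this
    have := mul_lt_mul_of_pos_left this (inv_pos.2 hu0)
    rw [inv_mul_cancel₀ hu0.ne'] at this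
    rw [inner_smul_right]
    linarith
  · rw [hsplit] at hu
    have := mul_lt_mul_of_pos_left hu (inv_pos.2 hu0)
    rw [inv_mul_cancel₀ hu0.ne'] at this
    rw [inner_smul_right]
    linarith

/-- A convex function which does not grow superlinearly from `x` to `(1 + δ) • x` is linear on
the whole segment `[0, (1 + δ) • x]`. -/
theorem GeomConvexOn.rayLinear_of_le {n : ℕ} {f : Euc n → ℝ≥0∞} (hf : GeomConvexOn f)
    (x : Euc n) {δ : ℝ} (hδ : 0 < δ)
    (hle : f ((1 + δ) • x) ≤ ENNReal.ofReal ((1 + δ) * (f x).toReal)) :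
    RayLinear f ((1 + δ) • x) := by
  have ha : 0 ≤ (f x).toReal := ENNReal.toReal_nonneg
  refine ⟨(1 + δ) * (f x).toReal, by positivity, fun t ⟨ht0, ht1⟩ => ?_⟩
  have hub : f (t • (1 + δ) • x) ≤ ENNReal.ofReal ((1 + δ) * (f x).toReal * t) := by
    calc f (t • (1 + δ) • x) ≤ ENNReal.ofReal t * f ((1 + δ) • x) := hf.le_smul _ ht0 ht1
      _ ≤ ENNReal.ofReal t * ENNReal.ofReal ((1 + δ) * (f x).toReal) := by gcongr
      _ = _ := by rw [← ENNReal.ofReal_mul ht0, mul_comm]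
  refine le_antisymm hub ?_
  have hfin : f (t • (1 + δ) • x) ≠ ∞ := ne_top_of_le_ne_top ENNReal.ofReal_ne_top hub
  rw [smul_smul] at hfin ⊢
  refine ENNReal.ofReal_le_of_le_toReal ?_
  set F := (f ((t * (1 + δ)) • x)).toReal with hF
  have hF0 : 0 ≤ F := ENNReal.toReal_nonneg
  have hFe : f ((t * (1 + δ)) • x) = ENNReal.ofReal F := (ENNReal.ofReal_toReal hfin).symm
  rcases le_total (t * (1 + δ)) 1 with hs | hs
  · have hd : 0 < 1 + δ - t * (1 + δ) := by linarith
    have key := hf.1 ((t * (1 + δ)) • x) ((1 + δ) • x) (δ / (1 + δ - t * (1 + δ)))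
      ((1 - t * (1 + δ)) / (1 + δ - t * (1 + δ))) (by positivity)
      (div_nonneg (by linarith) hd.le)
      (by rw [← add_div, div_eq_one_iff_eq hd.ne']; ring)
    have hx : (δ / (1 + δ - t * (1 + δ))) • (t * (1 + δ)) • x +
        ((1 - t * (1 + δ)) / (1 + δ - t * (1 + δ))) • (1 + δ) • x = x := by
      rw [smul_smul, smul_smul, ← add_smul]
      convert one_smul ℝ x using 2
      rw [div_mul_eq_mul_div, div_mul_eq_mul_div, ← add_div, div_eq_one_iff_eq hd.ne']
      ring
    have hμ : 0 ≤ (1 - t * (1 + δ)) / (1 + δ - t * (1 + δ)) := div_nonneg (by linarith) hd.le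
    rw [hx, hFe] at key
    have key' : f x ≤ ENNReal.ofReal (δ / (1 + δ - t * (1 + δ)) * F +
        (1 - t * (1 + δ)) / (1 + δ - t * (1 + δ)) * ((1 + δ) * (f x).toReal)) := by
      rw [ENNReal.ofReal_add (by positivity) (mul_nonneg hμ (by positivity)),
        ENNReal.ofReal_mul (by positivity), ENNReal.ofReal_mul hμ]
      exact key.trans (by gcongr)
    have hr := ENNReal.toReal_le_of_le_ofReal
      (add_nonneg (by positivity) (mul_nonneg hμ (by positivity))) key'
    have hr' : (f x).toReal * (1 + δ - t * (1 + δ)) ≤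
        δ * F + (1 - t * (1 + δ)) * ((1 + δ) * (f x).toReal) := by
      rwa [div_mul_eq_mul_div, div_mul_eq_mul_div, ← add_div, le_div_iff₀ hd] at hr
    have : 0 ≤ δ * (F - (1 + δ) * (f x).toReal * t) := by linarith
    linarith [nonneg_of_mul_nonneg_right this hδ]
  · have hs0 : 0 < t * (1 + δ) := by linarith
    have key := hf.le_smul ((t * (1 + δ)) • x) (inv_nonneg.2 hs0.le) (inv_le_one_of_one_le₀ hs)
    rw [smul_smul, inv_mul_cancel₀ hs0.ne', one_smul, hFe,
      ← ENNReal.ofReal_mul (by positivity)] at key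
    have hr := ENNReal.toReal_le_of_le_ofReal (by positivity) key
    rw [inv_mul_eq_div, le_div_iff₀ hs0] at hr
    linarith

/-- A nonnegative function vanishing and differentiable at the origin has zero slope along
every segment on which it is linear. -/
theorem RayLinear.eq_zero_of_differentiableAt {n : ℕ} {f : Euc n → ℝ≥0∞} (hf0 : f 0 = 0)
    (hd : DifferentiableAt ℝ (fun z => (f z).toReal) (0 : Euc n)) {w : Euc n}
    (hw : RayLinear f w) {t : ℝ} (ht : t ∈ Icc (0 : ℝ) 1) : f (t • w) = 0 := by
  obtain ⟨c, hc, hlin⟩ := hw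
  have hmin : IsLocalMin (fun z => (f z).toReal) (0 : Euc n) :=
    Filter.Eventually.of_forall fun z => by simp [hf0]
  have hfd : HasFDerivAt (fun z => (f z).toReal) (0 : Euc n →L[ℝ] ℝ) ((0 : ℝ) • w) := by
    rw [zero_smul, ← hmin.fderiv_eq_zero]
    exact hd.hasFDerivAt
  have hline : HasDerivAt (fun s : ℝ => s • w) w 0 := by
    simpa using (hasDerivAt_id (0 : ℝ)).smul_const w
  have h1 : HasDerivWithinAt (fun s : ℝ => (f (s • w)).toReal) 0 (Icc 0 1) 0 := by
    simpa [Function.comp_def] using (hfd.comp_hasDerivAt (0 : ℝ) hline).hasDerivWithinAt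
  have h2 : HasDerivWithinAt (fun s : ℝ => (f (s • w)).toReal) c (Icc 0 1) 0 := by
    have : HasDerivWithinAt (fun s : ℝ => c * s) c (Icc 0 1) 0 := by
      simpa using ((hasDerivAt_id (0 : ℝ)).const_mul c).hasDerivWithinAt
    refine this.congr (fun s hs => ?_) ?_
    · rw [hlin s hs, ENNReal.toReal_ofReal (mul_nonneg hc hs.1)]
    · simp [hf0]
  have hc0 : c = 0 :=
    (uniqueDiffOn_Icc zero_lt_one 0 (by simp)).eq_deriv _ h2 h1
  simp [hlin t ht, hc0]

/-- Lemma 2.2: for `f ∈ Cvx₀(ℝⁿ)` and `x` with `f(x) ∉ {0, ∞}`, if `f` is differentiable at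
the origin or, more generally, if `f` is not linear on `[0,(1+δ)x]` for any `δ > 0`,
then `f(x) · Jf(x/f(x)) = 1`, where `Jf = L(Pf)`. -/
theorem stmt_4 {n : ℕ} (f : Euc n → ℝ≥0∞) (hf : GeomConvexOn f) (x : Euc n)
    (h0 : f x ≠ 0) (hi : f x ≠ ∞)
    (h : DifferentiableAt ℝ (fun z => (f z).toReal) (0 : Euc n) ∨
         ¬ ∃ δ : ℝ, 0 < δ ∧ RayLinear f ((1 + δ) • x)) :
    f x * legendreT (polarT f) ((f x).toReal⁻¹ • x) = 1 := by
  have hray : ¬ ∃ δ : ℝ, 0 < δ ∧ RayLinear f ((1 + δ) • x) := by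
    rcases h with hd | h
    · rintro ⟨δ, hδ, hr⟩
      have hδ1 : 0 < 1 + δ := by linarith
      have := hr.eq_zero_of_differentiableAt hf.2.2 hd (t := (1 + δ)⁻¹)
        ⟨by positivity, inv_le_one_of_one_le₀ (by linarith)⟩
      rw [smul_smul, inv_mul_cancel₀ hδ1.ne', one_smul] at this
      exact h0 this
    · exact h
  have ha : 0 < (f x).toReal := ENNReal.toReal_pos h0 hi
  refine le_antisymm ?_ ?_
  · calc f x * legendreT (polarT f) ((f x).toReal⁻¹ • x) ≤ f x * (f x)⁻¹ := by
          gcongr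
          exact legendreT_polarT_le_inv f x h0 hi
      _ = 1 := ENNReal.mul_inv_cancel h0 hi
  · have hlower : ∀ δ : ℝ, 0 < δ →
        ENNReal.ofReal (1 + δ)⁻¹ ≤ f x * legendreT (polarT f) ((f x).toReal⁻¹ • x) := by
      intro δ hδ
      have hδ1 : 0 < 1 + δ := by linarith
      obtain ⟨y, c, hc, hy, hsep⟩ := hf.exists_separating ((1 + δ) • x)
        ((1 + δ) * (f x).toReal)
        fun hmem => hray ⟨δ, hδ, hf.rayLinear_of_le x hδ hmem.1⟩
      have hval : (1 + δ)⁻¹ ≤ ⟪x, y⟫ - c * (f x).toReal := by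
        rw [inner_smul_left] at hsep
        rw [inv_le_iff_one_le_mul₀' hδ1]
        simp only [conj_trivial] at hsep
        linarith
      calc ENNReal.ofReal (1 + δ)⁻¹
          ≤ ENNReal.ofReal ((f x).toReal * (⟪y, (f x).toReal⁻¹ • x⟫ - c)) := by
            refine ENNReal.ofReal_le_ofReal (hval.trans_eq ?_)
            rw [inner_smul_right, real_inner_comm]
            field_simp
        _ = f x * (ENNReal.ofReal ⟪y, (f x).toReal⁻¹ • x⟫ - ENNReal.ofReal c) := by
            rw [ENNReal.ofReal_mul ha.le, ENNReal.ofReal_toReal hi, ENNReal.ofReal_sub _ hc]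
        _ ≤ f x * legendreT (polarT f) ((f x).toReal⁻¹ • x) := by
            gcongr
            exact (tsub_le_tsub_left (polarT_le_ofReal f y c hc hy) _).trans
              (le_iSup (fun z => ENNReal.ofReal ⟪z, (f x).toReal⁻¹ • x⟫ - polarT f z) y)
    have hlim : Filter.Tendsto (fun δ : ℝ => ENNReal.ofReal (1 + δ)⁻¹) (nhdsWithin 0 (Ioi 0))
        (nhds 1) := by
      have hcont : ContinuousAt (fun δ : ℝ => ENNReal.ofReal (1 + δ)⁻¹) 0 :=
        ENNReal.continuous_ofReal.continuousAt.comp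
          ((continuousAt_const.add continuousAt_id).inv₀ (by simp))
      simpa using hcont.tendsto.mono_left nhdsWithin_le_nhds
    exact le_of_tendsto hlim (eventually_mem_nhdsWithin.mono hlower)
end
end

section
/- Let f ∈ S₂(ℝⁿ), let x ∈ ℝⁿ∖{0}, and let y = ∇°f(x). If Pf restricted to the segment [0,y] is not linear, then Pf is twice differentiable at y, its Hessian ∇²(Pf)(y) is positive definite, the matrix identity (∇²(Pf)(y))⁻¹ = f(x)·Pf(y)·(I − x⊗y)ᵀ · ∇²f(x) · (I − x⊗y) holds (where x⊗y is the matrix with entries xᵢyⱼ), and consequently det(∇²f(x)) · det(∇²(Pf)(y)) = (f(x)·Pf(y))^{−(n+2)}. -/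
open scoped ENNReal RealInnerProductSpace
open Set

noncomputable section

/-- A finite value of the polarity transform is attained as an infimum. -/
lemma inner_le_of_polarT_ne_top {n : ℕ} {f : Euc n → ℝ≥0∞} (hfin : ∀ z, f z ≠ ∞) {w : Euc n}
    (hw : polarT f w ≠ ∞) (z : Euc n) :
    ⟪z, w⟫ ≤ 1 + (polarT f w).toReal * (f z).toReal := by
  have hmem : polarT f w ∈ {c : ℝ≥0∞ | ∀ x : Euc n, ENNReal.ofReal ⟪x, w⟫ ≤ 1 + c * f x} := by
    refine IsClosed.csInf_mem ?_ ?_ (OrderBot.bddBelow _)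
    · simp only [ofPred_forall]
      refine isClosed_iInter fun x => isClosed_le continuous_const ?_
      exact continuous_const.add (ENNReal.continuous_mul_const (hfin x))
    · by_contra h
      rw [Set.not_nonempty_iff_eq_empty] at h
      exact hw (by rw [polarT, h, sInf_empty])
  have h := hmem z
  have hm : polarT f w * f z ≠ ∞ := ENNReal.mul_ne_top hw (hfin z)
  have h2 := (ENNReal.ofReal_le_iff_le_toReal (by finiteness)).1 h
  rwa [ENNReal.toReal_add (by simp) hm, ENNReal.toReal_mul, ENNReal.toReal_one] at h2

/-- A supporting hyperplane touching the graph at `x` computes the polarity transform. -/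
lemma polarT_eq_ofReal {n : ℕ} {f : Euc n → ℝ≥0∞} (hfin : ∀ z, f z ≠ ∞) {x w : Euc n} {c : ℝ}
    (hc : 0 ≤ c) (hx : 0 < (f x).toReal) (hle : ∀ z, ⟪z, w⟫ ≤ 1 + c * (f z).toReal)
    (heq : ⟪x, w⟫ = 1 + c * (f x).toReal) : polarT f w = ENNReal.ofReal c := by
  have hmem : ∀ z : Euc n, ENNReal.ofReal ⟪z, w⟫ ≤ 1 + ENNReal.ofReal c * f z := fun z => by
    refine ENNReal.ofReal_le_of_le_toReal ?_
    have hm : ENNReal.ofReal c * f z ≠ ∞ := ENNReal.mul_ne_top (by simp) (hfin z)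
    rw [ENNReal.toReal_add (by simp) hm, ENNReal.toReal_mul, ENNReal.toReal_one,
      ENNReal.toReal_ofReal hc]
    exact hle z
  have hlow : polarT f w ≤ ENNReal.ofReal c := sInf_le hmem
  have htop : polarT f w ≠ ∞ := ne_top_of_le_ne_top (by simp) hlow
  refine le_antisymm hlow (ENNReal.ofReal_le_of_le_toReal ?_)
  have h := inner_le_of_polarT_ne_top hfin htop x
  rw [heq] at h
  exact le_of_mul_le_mul_right (by linarith) hx

section RankOne

variable {E : Type*} [NormedAddCommGroup E] [InnerProductSpace ℝ E]

/-- A differentiable convex function lies above its tangent planes. -/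
lemma ConvexOn.add_inner_gradient_le {F : E → ℝ} [CompleteSpace E] (hF : ConvexOn ℝ univ F)
    {x g : E} (hg : HasGradientAt F g x) (z : E) : F x + ⟪z - x, g⟫ ≤ F z := by
  have hline : ConvexOn ℝ univ (fun t : ℝ => F (AffineMap.lineMap x z t)) :=
    hF.comp_affineMap (AffineMap.lineMap x z)
  have hd : HasDerivAt (fun t : ℝ => F (AffineMap.lineMap x z t)) ⟪g, z - x⟫ 0 := by
    have h1 : HasFDerivAt F (InnerProductSpace.toDual ℝ E g)
        (AffineMap.lineMap x z (0 : ℝ)) := by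
      simpa using hg.hasFDerivAt
    exact (h1.comp_hasDerivAt (0 : ℝ) AffineMap.hasDerivAt_lineMap).congr_deriv (by simp)
  have h := hline.le_slope_of_hasDerivAt (mem_univ 0) (mem_univ 1) one_pos hd
  simp only [slope_def_field, AffineMap.lineMap_apply_one, AffineMap.lineMap_apply_zero, sub_zero,
    div_one] at h
  rw [real_inner_comm]
  linarith

/-- The rank-one perturbation `I - x ⊗ y` of the identity. -/
def idSubTensor (x y : E) : E →L[ℝ] E :=
  ContinuousLinearMap.id ℝ E - (innerSL ℝ y).smulRight x

lemma idSubTensor_apply (x y v : E) : idSubTensor x y v = v - ⟪y, v⟫ • x := by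
  simp [idSubTensor]

lemma inner_idSubTensor_left (x y v w : E) :
    ⟪idSubTensor y x v, w⟫ = ⟪v, idSubTensor x y w⟫ := by
  simp only [idSubTensor_apply, inner_sub_left, inner_sub_right, inner_smul_left,
    inner_smul_right, RCLike.conj_to_real]
  rw [real_inner_comm x v]
  ring

lemma idSubTensor_injective {x y : E} (h : ⟪x, y⟫ ≠ 1) :
    Function.Injective (idSubTensor x y) := by
  refine (injective_iff_map_eq_zero _).2 fun v hv => ?_
  rw [idSubTensor_apply, sub_eq_zero] at hv
  have h1 : ⟪y, v⟫ * (1 - ⟪x, y⟫) = 0 := by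
    have := congrArg (fun u => ⟪y, u⟫) hv
    simp only [inner_smul_right] at this
    rw [real_inner_comm x y] at this
    linarith
  rcases mul_eq_zero.1 h1 with h0 | h0
  · rw [hv, h0, zero_smul]
  · exact absurd (by linarith) h

lemma det_idSubTensor [FiniteDimensional ℝ E] (x y : E) :
    LinearMap.det (idSubTensor x y).toLinearMap = 1 - ⟪x, y⟫ := by
  have : (idSubTensor x y).toLinearMap
      = LinearMap.transvection (-(innerSL ℝ y).toLinearMap) x := by
    ext v
    simp [idSubTensor_apply, LinearMap.transvection.apply, sub_eq_add_neg]
  rw [this, LinearMap.transvection.det]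
  simp [real_inner_comm, sub_eq_add_neg]

end RankOne

/-- The candidate for the polar gradient map, expressed through the Legendre transform. -/
def polarGrad {n : ℕ} (F : Euc n → ℝ) (z : Euc n) : Euc n :=
  (⟪z, gradient F z⟫ - F z)⁻¹ • gradient F z

lemma ContDiffAt.gradient_one {n : ℕ} {F : Euc n → ℝ} {x : Euc n} (hF : ContDiffAt ℝ 2 F x) :
    ContDiffAt ℝ 1 (gradient F) x :=
  (InnerProductSpace.toDual ℝ (Euc n)).symm.contDiff.contDiffAt.comp x
    (hF.fderiv_right (m := 1) (by norm_num))

lemma contDiffAt_polarGrad {n : ℕ} {F : Euc n → ℝ} {x : Euc n} (hF : ContDiffAt ℝ 2 F x)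
    (hx : ⟪x, gradient F x⟫ - F x ≠ 0) : ContDiffAt ℝ 1 (polarGrad F) x :=
  (((contDiffAt_id.inner ℝ hF.gradient_one).sub (hF.of_le (by norm_num))).inv hx).smul
    hF.gradient_one

lemma hasFDerivAt_polarGrad {n : ℕ} {F : Euc n → ℝ} {x : Euc n} (hF : ContDiffAt ℝ 2 F x)
    (hx : ⟪x, gradient F x⟫ - F x ≠ 0) :
    HasFDerivAt (polarGrad F) ((⟪x, gradient F x⟫ - F x)⁻¹ •
      (idSubTensor (polarGrad F x) x).comp (hess F x)) x := by
  have hg : HasFDerivAt (gradient F) (hess F x) x :=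
    (hF.gradient_one.differentiableAt (by norm_num)).hasFDerivAt
  have hF1 : HasFDerivAt F (InnerProductSpace.toDual ℝ _ (gradient F x)) x :=
    (hF.differentiableAt (by norm_num)).hasGradientAt.hasFDerivAt
  have h := ((hasDerivAt_inv hx).comp_hasFDerivAt x
    (((hasFDerivAt_id x).inner ℝ hg).sub hF1)).smul hg
  refine h.congr_fderiv ?_
  ext1 v
  simp [polarGrad, idSubTensor_apply, smul_smul, smul_sub]
  rw [sub_eq_add_neg (_ • (hess F x) v), ← neg_smul]
  simp only [← inv_pow]
  congr 2
  ring

/-- The polarity transform along the polar gradient map. -/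
lemma polarT_polarGrad {n : ℕ} {f : Euc n → ℝ≥0∞} (hfin : ∀ z, f z ≠ ∞)
    (hconv : ConvexOn ℝ univ fun z => (f z).toReal) {z : Euc n}
    (hd : DifferentiableAt ℝ (fun z => (f z).toReal) z) (hz : 0 < (f z).toReal)
    (hh : 0 < ⟪z, gradient (fun z => (f z).toReal) z⟫ - (f z).toReal) :
    polarT f (polarGrad (fun z => (f z).toReal) z) =
      ENNReal.ofReal (⟪z, gradient (fun z => (f z).toReal) z⟫ - (f z).toReal)⁻¹ := by
  refine polarT_eq_ofReal hfin (inv_nonneg.2 hh.le) hz (fun u => ?_) ?_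
  · have h := hconv.add_inner_gradient_le hd.hasGradientAt u
    rw [inner_sub_left] at h
    rw [polarGrad, inner_smul_right, ← sub_nonneg]
    refine (mul_nonneg (inv_nonneg.2 hh.le) (sub_nonneg.2 h)).trans_eq ?_
    field_simp
    ring
  · rw [polarGrad, inner_smul_right]
    field_simp
    ring

/-- The gradient of the polarity transform at a point where its supremum is attained at `z`. -/
lemma hasGradientAt_polarT {n : ℕ} {f : Euc n → ℝ≥0∞} (hfin : ∀ z, f z ≠ ∞) {z w : Euc n}
    (hz : 0 < (f z).toReal) (htop : ∀ᶠ u in nhds w, polarT f u ≠ ∞)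
    (heq : ⟪z, w⟫ = 1 + (polarT f w).toReal * (f z).toReal)
    (hd : DifferentiableAt ℝ (fun u => (polarT f u).toReal) w) :
    HasGradientAt (fun u => (polarT f u).toReal) ((f z).toReal⁻¹ • z) w := by
  have hmin : IsLocalMin (fun u => 1 + (polarT f u).toReal * (f z).toReal - ⟪z, u⟫) w := by
    filter_upwards [htop] with u hu
    have := inner_le_of_polarT_ne_top hfin hu z
    linarith
  have h0 := hmin.hasFDerivAt_eq_zero
    (((hd.hasFDerivAt.mul_const (f z).toReal).const_add 1).sub (innerSL ℝ z).hasFDerivAt)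
  rw [hasGradientAt_iff_hasFDerivAt]
  refine hd.hasFDerivAt.congr_fderiv ?_
  ext1 v
  have h1 := congrArg (fun L => L v) h0
  simp [sub_eq_zero] at h1
  simp [← h1, hz.ne']

lemma toReal_pos_of_strictConvex {n : ℕ} {f : Euc n → ℝ≥0∞}
    (hconv : StrictConvexOn ℝ univ fun z => (f z).toReal) (h0 : f 0 = 0) {z : Euc n}
    (hz : z ≠ 0) : 0 < (f z).toReal := by
  have h := hconv.2 (mem_univ z) (mem_univ 0) hz
    (one_half_pos (α := ℝ)) one_half_pos (add_halves 1)
  simp only [h0, ENNReal.toReal_zero, smul_eq_mul, mul_zero, add_zero] at h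
  have := ENNReal.toReal_nonneg (a := f ((1 / 2 : ℝ) • z + (1 / 2 : ℝ) • 0))
  linarith

/-- Polar subgradients have positive polar value, and are a multiple of the gradient. -/
lemma polarSubdiff_first_order {n : ℕ} {f : Euc n → ℝ≥0∞} (hfin : ∀ z, f z ≠ ∞) {x y : Euc n}
    (hd : DifferentiableAt ℝ (fun z => (f z).toReal) x) (hy : y ∈ polarSubdiff f x) :
    ⟪x, y⟫ = 1 + (polarT f y).toReal * (f x).toReal ∧ 0 < (polarT f y).toReal ∧
      y = (polarT f y).toReal • gradient (fun z => (f z).toReal) x := by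
  obtain ⟨htop, heq⟩ := hy
  have heq : ⟪x, y⟫ = 1 + (polarT f y).toReal * (f x).toReal := by
    rw [← EReal.coe_ennreal_mul, ← ENNReal.ofReal_toReal (ENNReal.mul_ne_top htop (hfin x)),
      EReal.coe_ennreal_ofReal, max_eq_left ENNReal.toReal_nonneg, EReal.coe_eq_coe_iff,
      ENNReal.toReal_mul] at heq
    linarith
  have hle := inner_le_of_polarT_ne_top hfin htop
  refine ⟨heq, ?_, ?_⟩
  · refine ENNReal.toReal_nonneg.lt_of_ne fun h => ?_
    have h2 := hle ((2 : ℝ) • x)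
    rw [← h] at heq h2
    rw [real_inner_smul_left, heq] at h2
    norm_num at h2
  · have hmin : IsLocalMin (fun z => 1 + (polarT f y).toReal * (f z).toReal - ⟪y, z⟫) x := by
      filter_upwards with z
      have := hle z
      rw [real_inner_comm x y, real_inner_comm z y]
      linarith
    have h0 := hmin.hasFDerivAt_eq_zero
      (((hd.hasFDerivAt.const_mul (polarT f y).toReal).const_add 1).sub
        (innerSL ℝ y).hasFDerivAt)
    refine ext_inner_right ℝ fun v => ?_
    have h1 := congrArg (fun L => L v) h0
    simp [sub_eq_zero] at h1
    simp [inner_smul_left, h1]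

/-- Inversion of the polar gradient: the polarity transform is twice differentiable at the polar
gradient of `x`, with Hessian determined by the chain rule. -/
lemma hasFDerivAt_gradient_polarT {n : ℕ} {f : Euc n → ℝ≥0∞} (hfin : ∀ z, f z ≠ ∞)
    (hconv : ConvexOn ℝ univ fun z => (f z).toReal) {x : Euc n}
    (hd : ContDiffAt ℝ 2 (fun z => (f z).toReal) x) (hx : 0 < (f x).toReal)
    (hh : 0 < ⟪x, gradient (fun z => (f z).toReal) x⟫ - (f x).toReal)
    (e : Euc n ≃L[ℝ] Euc n)
    (he : HasFDerivAt (polarGrad fun z => (f z).toReal) (e : Euc n →L[ℝ] Euc n) x) :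
    DifferentiableAt ℝ (fun w => (polarT f w).toReal) (polarGrad (fun z => (f z).toReal) x) ∧
    HasFDerivAt (gradient fun w => (polarT f w).toReal)
      ((fderiv ℝ (fun z => (f z).toReal⁻¹ • z) x).comp (e.symm : Euc n →L[ℝ] Euc n))
      (polarGrad (fun z => (f z).toReal) x) := by
  set F : Euc n → ℝ := fun z => (f z).toReal
  set h : Euc n → ℝ := fun z => ⟪z, gradient F z⟫ - F z with hhdef
  have hΦ := contDiffAt_polarGrad hd hh.ne'
  have hS := hΦ.hasStrictFDerivAt' he one_ne_zero
  set Ψ := hΦ.localInverse he one_ne_zero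
  have hΨ : ContDiffAt ℝ 1 Ψ (polarGrad F x) := hΦ.to_localInverse he one_ne_zero
  have hΨx : Ψ (polarGrad F x) = x := hΦ.localInverse_apply_image he one_ne_zero
  have hΨ' : HasFDerivAt Ψ (e.symm : Euc n →L[ℝ] Euc n) (polarGrad F x) :=
    hS.to_localInverse.hasFDerivAt
  have hΨt : Filter.Tendsto Ψ (nhds (polarGrad F x)) (nhds x) := hS.localInverse_tendsto
  have hright : ∀ᶠ w in nhds (polarGrad F x), polarGrad F (Ψ w) = w := hS.eventually_right_inverse
  have hhc : ContDiffAt ℝ 1 h x :=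
    (contDiffAt_id.inner ℝ hd.gradient_one).sub (hd.of_le (by norm_num))
  have hgood : ∀ᶠ z in nhds x, DifferentiableAt ℝ F z ∧ 0 < F z ∧ 0 < h z := by
    filter_upwards [hd.eventually (by simp), hd.continuousAt.eventually (lt_mem_nhds hx),
      hhc.continuousAt.eventually (lt_mem_nhds hh)] with z h1 h2 h3
    exact ⟨h1.differentiableAt (by norm_num), h2, h3⟩
  have hval : ∀ᶠ w in nhds (polarGrad F x), polarT f w = ENNReal.ofReal (h (Ψ w))⁻¹ := by
    filter_upwards [hright, hΨt.eventually hgood] with w hw ⟨h1, h2, h3⟩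
    have := polarT_polarGrad hfin hconv h1 h2 h3
    rwa [hw] at this
  have hvalReal : (fun w => (polarT f w).toReal) =ᶠ[nhds (polarGrad F x)] fun w => (h (Ψ w))⁻¹ := by
    filter_upwards [hval, hΨt.eventually hgood] with w hw ⟨_, _, h3⟩
    rw [hw, ENNReal.toReal_ofReal (inv_nonneg.2 h3.le)]
  have hGc : ContDiffAt ℝ 1 (fun w => (polarT f w).toReal) (polarGrad F x) := by
    refine ContDiffAt.congr_of_eventuallyEq (ContDiffAt.inv ?_ ?_) hvalReal
    · exact ContDiffAt.comp _ (by rwa [hΨx]) hΨ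
    · rw [hΨx]; exact hh.ne'
  refine ⟨hGc.differentiableAt (by norm_num), ?_⟩
  have hgrad : gradient (fun w => (polarT f w).toReal) =ᶠ[nhds (polarGrad F x)]
      fun w => (F (Ψ w))⁻¹ • Ψ w := by
    filter_upwards [hGc.eventually (by simp), hval.eventually_nhds, hvalReal, hright,
      hΨt.eventually hgood] with w h1 h2 h3 h4 ⟨_, h5, h6⟩
    refine (hasGradientAt_polarT hfin h5 (h2.mono fun u hu => by simp [hu]) ?_
      (h1.differentiableAt (by norm_num))).gradient
    have h7 : ⟪Ψ w, polarGrad F (Ψ w)⟫ = 1 + (h (Ψ w))⁻¹ * F (Ψ w) := by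
      rw [polarGrad, inner_smul_right]
      change (h (Ψ w))⁻¹ * _ = _
      field_simp
      simp [hhdef]
    rw [h4] at h7
    rw [h7, h3]
  refine HasFDerivAt.congr_of_eventuallyEq ?_ hgrad
  have hB : DifferentiableAt ℝ (fun z => (F z)⁻¹ • z) x :=
    ((hd.differentiableAt (by norm_num)).inv hx.ne').smul differentiableAt_id
  refine HasFDerivAt.comp (g := fun z => (F z)⁻¹ • z) _ ?_ hΨ'
  rw [hΨx]
  exact hB.hasFDerivAt

/-- Proposition 4.2: the Hessian of `Pf` for `f ∈ S₂(ℝⁿ)`. With `y = ∇°f(x)`, if `Pf` is not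
linear on `[0,y]` then `Pf` is twice differentiable at `y`, `∇²(Pf)(y) > 0`,
`(∇²(Pf)(y))⁻¹ = f(x)·Pf(y)·(I - x⊗y)ᵀ ∇²f(x) (I - x⊗y)`, and
`det ∇²f(x) · det ∇²(Pf)(y) = (f(x)Pf(y))^{-(n+2)}`. -/
theorem stmt_11 {n : ℕ} (f : Euc n → ℝ≥0∞) (hf : S2 f) (x : Euc n) (hx : x ≠ 0)
    (y : Euc n) (hy : polarSubdiff f x = {y}) (hlin : ¬ RayLinear (polarT f) y) :
    DifferentiableAt ℝ (fun z => (polarT f z).toReal) y ∧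
    DifferentiableAt ℝ (fun z => gradient (fun w => (polarT f w).toReal) z) y ∧
    (∀ v : Euc n, v ≠ 0 → 0 < ⟪v, hess (fun w => (polarT f w).toReal) y v⟫) ∧
    (let A : Euc n →L[ℝ] Euc n :=
       ContinuousLinearMap.id ℝ (Euc n) - (innerSL ℝ y).smulRight x
     let At : Euc n →L[ℝ] Euc n :=
       ContinuousLinearMap.id ℝ (Euc n) - (innerSL ℝ x).smulRight y
     let M : Euc n →L[ℝ] Euc n :=
       ((f x).toReal * (polarT f y).toReal)
         • (At.comp ((hess (fun w => (f w).toReal) x).comp A))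
     M.comp (hess (fun w => (polarT f w).toReal) y) = ContinuousLinearMap.id ℝ (Euc n) ∧
     (hess (fun w => (polarT f w).toReal) y).comp M = ContinuousLinearMap.id ℝ (Euc n)) ∧
    LinearMap.det ((hess (fun w => (f w).toReal) x).toLinearMap) *
        LinearMap.det ((hess (fun w => (polarT f w).toReal) y).toLinearMap)
      = ((f x).toReal * (polarT f y).toReal) ^ (-(n + 2 : ℤ)) := by
  obtain ⟨⟨-, -, hzero⟩, hfin, hstrict, hsmooth, hpos⟩ := hf
  have hd : ContDiffAt ℝ 2 (fun z => (f z).toReal) x :=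
    hsmooth.contDiffAt (isOpen_compl_singleton.mem_nhds hx)
  have hd1 : DifferentiableAt ℝ (fun z => (f z).toReal) x := hd.differentiableAt (by norm_num)
  have hFx : 0 < (f x).toReal := toReal_pos_of_strictConvex hstrict hzero hx
  obtain ⟨hxy, hP, hgrad⟩ :=
    polarSubdiff_first_order hfin hd1 (by rw [hy]; exact mem_singleton y)
  have hHpos := hpos x hx
  set F : Euc n → ℝ := fun z => (f z).toReal
  set P : ℝ := (polarT f y).toReal
  set c : ℝ := (f x).toReal
  have hh : ⟪x, gradient F x⟫ - c = P⁻¹ := by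
    rw [hgrad, inner_smul_right] at hxy
    field_simp
    linarith
  have hyx : polarGrad F x = y := by
    change (⟪x, gradient F x⟫ - c)⁻¹ • gradient F x = y
    rw [hh, inv_inv, ← hgrad]
  have hxy1 : ⟪x, y⟫ ≠ 1 := by
    have := mul_pos hP hFx
    linarith
  set H := hess F x
  have hHinj : Function.Injective H := by
    refine (injective_iff_map_eq_zero _).2 fun v hv => ?_
    by_contra h0
    have := hHpos v h0
    simp [hv] at this
  set D : Euc n →L[ℝ] Euc n := P • (idSubTensor y x).comp H
  have hDinj : Function.Injective D := fun u v huv =>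
    hHinj (idSubTensor_injective (by rwa [real_inner_comm]) (smul_right_injective _ hP.ne' huv))
  let e : Euc n ≃L[ℝ] Euc n :=
    (LinearEquiv.ofInjectiveEndo D.toLinearMap hDinj).toContinuousLinearEquiv
  have heD : ∀ v, e v = P • idSubTensor y x (H v) := fun v => rfl
  have hΦ : HasFDerivAt (polarGrad F) (e : Euc n →L[ℝ] Euc n) x := by
    have hne : ⟪x, gradient F x⟫ - F x ≠ 0 := hh.trans_ne (inv_ne_zero hP.ne')
    refine (hasFDerivAt_polarGrad hd hne).congr_fderiv ?_
    ext1 v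
    have hh' : ⟪x, gradient F x⟫ - F x = P⁻¹ := hh
    simp only [hh', hyx, inv_inv]
    rfl
  obtain ⟨hG1, hG2⟩ := hasFDerivAt_gradient_polarT hfin hstrict.convexOn hd hFx
    (hh ▸ inv_pos.2 hP) e hΦ
  rw [hyx] at hG1 hG2
  set B := fderiv ℝ (fun z => (f z).toReal⁻¹ • z) x
  have hB : ∀ v, B v = c⁻¹ • v - (c⁻¹ ^ 2 * P⁻¹ * ⟪y, v⟫) • x := fun v => by
    have h1 : HasFDerivAt F (innerSL ℝ (P⁻¹ • y)) x := by
      have : P⁻¹ • y = gradient F x := by rw [hgrad, smul_smul, inv_mul_cancel₀ hP.ne', one_smul]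
      rw [this]
      exact hd1.hasGradientAt.hasFDerivAt
    have h2 := ((hasDerivAt_inv hFx.ne').comp_hasFDerivAt x h1).smul (hasFDerivAt_id x)
    have h3 : B = _ := h2.fderiv
    rw [h3]
    simp [sub_eq_add_neg, ← neg_smul, mul_assoc]
    rfl
  have hAB : ∀ v, idSubTensor x y (B v) = c⁻¹ • v := fun v => by
    rw [idSubTensor_apply, hB, inner_sub_right, inner_smul_right, inner_smul_right,
      real_inner_comm x y, hxy, sub_sub, ← add_smul, sub_eq_self]
    convert zero_smul ℝ x
    field_simp
    ring
  have hBA : ∀ v, B (idSubTensor x y v) = c⁻¹ • v := fun v =>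
    idSubTensor_injective hxy1 (by rw [hAB, map_smul])
  have hK : hess (fun w => (polarT f w).toReal) y = B.comp (e.symm : Euc n →L[ℝ] Euc n) :=
    hG2.fderiv
  rw [hK]
  change _ ∧ _ ∧ _ ∧
    (((c * P) • ((idSubTensor y x).comp (H.comp (idSubTensor x y)))).comp _ = _ ∧ _) ∧ _
  set M : Euc n →L[ℝ] Euc n := (c * P) • ((idSubTensor y x).comp (H.comp (idSubTensor x y)))
    with hM
  have hMe : ∀ v, M v = c • e (idSubTensor x y v) := fun v => by
    rw [heD, smul_smul]
    rfl
  have hMK : M.comp (B.comp (e.symm : Euc n →L[ℝ] Euc n)) = ContinuousLinearMap.id ℝ _ := by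
    ext1 v
    change M (B (e.symm v)) = v
    rw [hMe, hAB, map_smul, smul_smul, mul_inv_cancel₀ hFx.ne', one_smul, e.apply_symm_apply]
  have hKM : (B.comp (e.symm : Euc n →L[ℝ] Euc n)).comp M = ContinuousLinearMap.id ℝ _ := by
    ext1 v
    change B (e.symm (M v)) = v
    rw [hMe, map_smul, e.symm_apply_apply, map_smul, hBA, smul_smul, mul_inv_cancel₀ hFx.ne',
      one_smul]
  set K := B.comp (e.symm : Euc n →L[ℝ] Euc n)
  refine ⟨hG1, hG2.differentiableAt, fun v hv => ?_, ⟨hMK, hKM⟩, ?_⟩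
  · have hv' : M (K v) = v := congrArg (fun L => L v) hMK
    have hne : idSubTensor x y (K v) ≠ 0 := fun h0 => hv (by rw [← hv', hMe, h0]; simp)
    have key : ⟪M (K v), K v⟫ = c * P * ⟪idSubTensor x y (K v), H (idSubTensor x y (K v))⟫ := by
      change ⟪(c * P) • idSubTensor y x (H (idSubTensor x y (K v))), K v⟫ = _
      rw [real_inner_smul_left, inner_idSubTensor_left, real_inner_comm]
    rw [hv'] at key
    rw [key]
    exact mul_pos (mul_pos hFx hP) (hHpos _ hne)
  · have hdet : LinearMap.det M.toLinearMap * LinearMap.det K.toLinearMap = 1 := by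
      rw [← LinearMap.det_comp, ← ContinuousLinearMap.toLinearMap_comp, hMK]
      exact LinearMap.det_id
    have hdetM : LinearMap.det M.toLinearMap =
        (c * P) ^ (n + 2) * LinearMap.det H.toLinearMap := by
      rw [hM, ContinuousLinearMap.toLinearMap_smul, LinearMap.det_smul, ContinuousLinearMap.toLinearMap_comp,
        LinearMap.det_comp, ContinuousLinearMap.toLinearMap_comp, LinearMap.det_comp, det_idSubTensor,
        det_idSubTensor, real_inner_comm x y, hxy, finrank_euclideanSpace_fin]
      ring
    rw [hdetM, mul_assoc] at hdet
    rw [zpow_neg]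
    exact eq_inv_of_mul_eq_one_right (by exact_mod_cast hdet)
end
end
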